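/- (Local a posteriori null-space error bound, conservative Galerkin.) Under the stated hypotheses, the component of the state-space error in the null space of the constraints satisfies ‖Z̄_Gᵀ e^n‖ ≤ Σ_{ℓ=0}^k ε_ℓ ( κ ‖V̄_Gᵀ e^{n−ℓ}‖ + ‖(I_N − P_G) f(x_0 + Φ x̂^{n−ℓ}, t^{n−ℓ})‖ ) + Σ_{ℓ=1}^k γ_ℓ ‖Z̄_Gᵀ e^{n−ℓ}‖. -/

import Mathlib

open Matrix Finset

noncomputable def euclNorm {n : ℕ} (v : Fin n → ℝ) : ℝ := Real.sqrt (∑ i, v i ^ 2)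

theorem euclNorm_eq_norm_toLp {n : ℕ} (v : Fin n → ℝ) :
    euclNorm v = ‖(WithLp.toLp 2 v : EuclideanSpace ℝ (Fin n))‖ := by
  simp [euclNorm, EuclideanSpace.norm_eq]

theorem euclNorm_nonneg {n : ℕ} (v : Fin n → ℝ) : 0 ≤ euclNorm v := Real.sqrt_nonneg _

theorem euclNorm_add_le {n : ℕ} (v w : Fin n → ℝ) :
    euclNorm (v + w) ≤ euclNorm v + euclNorm w := by
  simpa only [euclNorm_eq_norm_toLp, WithLp.toLp_add] using norm_add_le _ _

theorem euclNorm_sub_le {n : ℕ} (v w : Fin n → ℝ) :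
    euclNorm (v - w) ≤ euclNorm v + euclNorm w := by
  simpa only [euclNorm_eq_norm_toLp, WithLp.toLp_sub] using norm_sub_le _ _

theorem euclNorm_smul {n : ℕ} (c : ℝ) (v : Fin n → ℝ) :
    euclNorm (c • v) = |c| * euclNorm v := by
  simp only [euclNorm_eq_norm_toLp, WithLp.toLp_smul, norm_smul, Real.norm_eq_abs]

theorem euclNorm_sum_le {n : ℕ} {ι : Type*} (s : Finset ι) (v : ι → Fin n → ℝ) :
    euclNorm (∑ i ∈ s, v i) ≤ ∑ i ∈ s, euclNorm (v i) := by
  simpa only [euclNorm_eq_norm_toLp, WithLp.toLp_sum] using norm_sum_le _ _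

theorem euclNorm_sq {n : ℕ} (v : Fin n → ℝ) : euclNorm v ^ 2 = v ⬝ᵥ v := by
  rw [euclNorm, Real.sq_sqrt (Finset.sum_nonneg fun i _ => sq_nonneg (v i))]
  simp [dotProduct, sq]

theorem dotProduct_mul_transpose_mulVec {n m : ℕ} (A : Matrix (Fin n) (Fin m) ℝ)
    (v : Fin n → ℝ) : v ⬝ᵥ (A * Aᵀ) *ᵥ v = Aᵀ *ᵥ v ⬝ᵥ Aᵀ *ᵥ v := by
  rw [← mulVec_mulVec, dotProduct_mulVec, ← mulVec_transpose]

/-- Pythagoras for a resolution of the identity. -/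
theorem euclNorm_sq_eq_add {n m l : ℕ} {A : Matrix (Fin n) (Fin m) ℝ}
    {B : Matrix (Fin n) (Fin l) ℝ} (hAB : A * Aᵀ + B * Bᵀ = 1) (v : Fin n → ℝ) :
    euclNorm v ^ 2 = euclNorm (Aᵀ *ᵥ v) ^ 2 + euclNorm (Bᵀ *ᵥ v) ^ 2 := by
  rw [euclNorm_sq, euclNorm_sq, euclNorm_sq, ← dotProduct_mul_transpose_mulVec,
    ← dotProduct_mul_transpose_mulVec, ← dotProduct_add, ← add_mulVec, hAB, one_mulVec]

theorem euclNorm_transpose_mulVec_le {n m l : ℕ} {A : Matrix (Fin n) (Fin m) ℝ}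
    {B : Matrix (Fin n) (Fin l) ℝ} (hAB : A * Aᵀ + B * Bᵀ = 1) (v : Fin n → ℝ) :
    euclNorm (Bᵀ *ᵥ v) ≤ euclNorm v := by
  refine le_of_abs_le (abs_le_of_sq_le_sq ?_ (euclNorm_nonneg v))
  rw [euclNorm_sq_eq_add hAB v]
  exact le_add_of_nonneg_left (sq_nonneg _)

theorem euclNorm_le_add_transpose_mulVec {n m l : ℕ} {A : Matrix (Fin n) (Fin m) ℝ}
    {B : Matrix (Fin n) (Fin l) ℝ} (hAB : A * Aᵀ + B * Bᵀ = 1) (v : Fin n → ℝ) :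
    euclNorm v ≤ euclNorm (Aᵀ *ᵥ v) + euclNorm (Bᵀ *ᵥ v) := by
  have hA := euclNorm_nonneg (Aᵀ *ᵥ v)
  have hB := euclNorm_nonneg (Bᵀ *ᵥ v)
  refine le_of_abs_le (abs_le_of_sq_le_sq ?_ (add_nonneg hA hB))
  rw [euclNorm_sq_eq_add hAB v]
  nlinarith [mul_nonneg hA hB]

/-- Local a posteriori error bound for the component of the conservative
Galerkin state-space error in the null space of the constraints. -/
theorem conservative_galerkin_nullspace_error_bound
    (N Nb p k : ℕ) (hN : 0 < N) (hNb : 0 < Nb) (hp : 0 < p) (hk : 1 ≤ k)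
    (Φ : Matrix (Fin N) (Fin p) ℝ) (hΦ : Φᵀ * Φ = 1)
    (C : Matrix (Fin Nb) (Fin N) ℝ)
    (Δt : ℝ) (hΔt : 0 < Δt)
    (α β : ℕ → ℝ) (hα0 : α 0 ≠ 0)
    (t : ℕ → ℝ) (x0 : Fin N → ℝ)
    (f : (Fin N → ℝ) → ℝ → (Fin N → ℝ))
    (κ : ℝ) (hκ : 0 < κ)
    (hLip : ∀ x y s, euclNorm (f x s - f y s) ≤ κ * euclNorm (x - y))
    (h : ℝ) (hdef : h = |α 0| - |β 0| * κ * Δt)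
    (hstab : |β 0| * κ * Δt < |α 0|)
    (ε γ : ℕ → ℝ)
    (hε : ∀ ℓ, ε ℓ = |β ℓ| * Δt / h)
    (hγ : ∀ ℓ, γ ℓ = (|α ℓ| + |β ℓ| * κ * Δt) / h)
    (rhat : (ℕ → Fin N → ℝ) → (Fin N → ℝ))
    (hrhat : ∀ y, rhat y = ∑ ℓ ∈ Finset.Icc 1 k,
      ((β ℓ * Δt) • f (x0 + y ℓ) (t ℓ) - α ℓ • y ℓ))
    (x : ℕ → Fin N → ℝ)
    (hFOM : α 0 • x 0 = (β 0 * Δt) • f (x0 + x 0) (t 0) + rhat x)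
    (xh : ℕ → Fin p → ℝ) (lam : ℕ → Fin Nb → ℝ)
    (hROM : α 0 • xh 0 = (β 0 * Δt) • Φᵀ.mulVec (f (x0 + Φ.mulVec (xh 0)) (t 0))
      + Φᵀ.mulVec (rhat (fun ℓ => Φ.mulVec (xh ℓ)))
      - ∑ j ∈ Finset.range (k + 1), α j • (Φᵀ * Cᵀ).mulVec (lam j))
    (r : ℕ) (hr : r = (C * Φ).rank)
    (U : Matrix (Fin Nb) (Fin r) ℝ) (Sg : Matrix (Fin r) (Fin r) ℝ)
    (V : Matrix (Fin p) (Fin r) ℝ)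
    (hU : Uᵀ * U = 1) (hV : Vᵀ * V = 1)
    (hSdiag : ∀ i j : Fin r, i ≠ j → Sg i j = 0)
    (hSpos : ∀ i : Fin r, 0 < Sg i i)
    (hSVD : C * Φ = U * Sg * Vᵀ)
    (Vb : Matrix (Fin N) (Fin r) ℝ) (hVb : Vb = Φ * V)
    (Z : Matrix (Fin N) (Fin (N - r)) ℝ)
    (hZ : Zᵀ * Z = 1) (hZV : Zᵀ * Vb = 0)
    (hdecomp : Vb * Vbᵀ + Z * Zᵀ = 1)
    (e : ℕ → Fin N → ℝ) (he : ∀ m, e m = x m - Φ.mulVec (xh m)) :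
    euclNorm (Zᵀ.mulVec (e 0)) ≤
      (∑ ℓ ∈ Finset.range (k + 1), ε ℓ * (κ * euclNorm (Vbᵀ.mulVec (e ℓ))
        + euclNorm ((1 - Φ * Φᵀ).mulVec (f (x0 + Φ.mulVec (xh ℓ)) (t ℓ)))))
      + ∑ ℓ ∈ Finset.Icc 1 k, γ ℓ * euclNorm (Zᵀ.mulVec (e ℓ)) := by
  have hh : 0 < h := by rw [hdef]; linarith
  have hZC : (Zᵀ * Φ) * (Φᵀ * Cᵀ) = 0 := by
    rw [← transpose_mul, hSVD, transpose_mul, transpose_transpose, Matrix.mul_assoc,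
      ← Matrix.mul_assoc Φ, ← hVb, ← Matrix.mul_assoc, hZV, Matrix.zero_mul]
  have hproj (w : Fin N → ℝ) :
      (Zᵀ * Φ) *ᵥ (Φᵀ *ᵥ w) = Zᵀ *ᵥ w - Zᵀ *ᵥ ((1 - Φ * Φᵀ) *ᵥ w) := by
    rw [sub_mulVec, one_mulVec, mulVec_sub, sub_sub_cancel, mulVec_mulVec, mulVec_mulVec,
      Matrix.mul_assoc]
  have hbasis (y : Fin p → ℝ) : (Zᵀ * Φ) *ᵥ (Φᵀ *ᵥ (Φ *ᵥ y)) = Zᵀ *ᵥ (Φ *ᵥ y) := by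
    rw [mulVec_mulVec y, hΦ, one_mulVec, mulVec_mulVec]
  set d : ℕ → Fin N → ℝ := fun ℓ => f (x0 + x ℓ) (t ℓ) - f (x0 + Φ *ᵥ xh ℓ) (t ℓ)
    + (1 - Φ * Φᵀ) *ᵥ f (x0 + Φ *ᵥ xh ℓ) (t ℓ) with hd
  have herr : α 0 • Zᵀ *ᵥ e 0 = (β 0 * Δt) • Zᵀ *ᵥ d 0
      + ∑ ℓ ∈ Icc 1 k, ((β ℓ * Δt) • Zᵀ *ᵥ d ℓ - α ℓ • Zᵀ *ᵥ e ℓ) := by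
    have hfull := congrArg (Zᵀ *ᵥ ·) hFOM
    have hred := congrArg ((Zᵀ * Φ) *ᵥ ·) hROM
    simp only [hrhat, mulVec_add, mulVec_sub, mulVec_smul, mulVec_sum] at hfull hred
    have hlam (j : ℕ) : (Zᵀ * Φ) *ᵥ ((Φᵀ * Cᵀ) *ᵥ lam j) = 0 := by
      rw [mulVec_mulVec, hZC, zero_mulVec]
    simp only [hlam, hproj (f _ _), hbasis, smul_zero, sum_const_zero, sub_zero] at hred
    rw [he, mulVec_sub, smul_sub, mulVec_mulVec, hfull, hred]
    have hsum : ∑ ℓ ∈ Icc 1 k, ((β ℓ * Δt) • Zᵀ *ᵥ d ℓ - α ℓ • Zᵀ *ᵥ e ℓ)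
        = ∑ ℓ ∈ Icc 1 k, ((β ℓ * Δt) • Zᵀ *ᵥ f (x0 + x ℓ) (t ℓ) - α ℓ • Zᵀ *ᵥ x ℓ)
        - ∑ ℓ ∈ Icc 1 k, ((β ℓ * Δt) • (Zᵀ *ᵥ f (x0 + Φ *ᵥ xh ℓ) (t ℓ)
            - Zᵀ *ᵥ ((1 - Φ * Φᵀ) *ᵥ f (x0 + Φ *ᵥ xh ℓ) (t ℓ)))
            - α ℓ • Zᵀ *ᵥ (Φ *ᵥ xh ℓ)) := by
      rw [← sum_sub_distrib]
      refine sum_congr rfl fun ℓ _ => ?_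
      simp only [hd, he, mulVec_add, mulVec_sub]
      module
    rw [hsum]
    simp only [hd, mulVec_add, mulVec_sub]
    module
  set u : ℕ → ℝ := fun ℓ => κ * euclNorm (Vbᵀ *ᵥ e ℓ)
    + euclNorm ((1 - Φ * Φᵀ) *ᵥ f (x0 + Φ *ᵥ xh ℓ) (t ℓ)) with hu
  set z : ℕ → ℝ := fun ℓ => euclNorm (Zᵀ *ᵥ e ℓ) with hz
  have hforce (ℓ : ℕ) :
      euclNorm ((β ℓ * Δt) • Zᵀ *ᵥ d ℓ) ≤ |β ℓ| * Δt * (u ℓ + κ * z ℓ) := by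
    rw [euclNorm_smul, abs_mul, abs_of_pos hΔt]
    refine mul_le_mul_of_nonneg_left ?_ (by positivity)
    have hlip := hLip (x0 + x ℓ) (x0 + Φ *ᵥ xh ℓ) (t ℓ)
    rw [add_sub_add_left_eq_sub, ← he] at hlip
    have hsplit := mul_le_mul_of_nonneg_left
      (euclNorm_le_add_transpose_mulVec hdecomp (e ℓ)) hκ.le
    calc euclNorm (Zᵀ *ᵥ d ℓ) ≤ euclNorm (d ℓ) := euclNorm_transpose_mulVec_le hdecomp _
      _ ≤ _ := euclNorm_add_le _ _
      _ ≤ u ℓ + κ * z ℓ := by simp only [hu, hz]; linarith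
  have hbound : |α 0| * z 0 ≤ |β 0| * Δt * (u 0 + κ * z 0)
      + ∑ ℓ ∈ Icc 1 k, (|β ℓ| * Δt * (u ℓ + κ * z ℓ) + |α ℓ| * z ℓ) := by
    rw [hz, ← euclNorm_smul, herr]
    refine (euclNorm_add_le _ _).trans (add_le_add (hforce 0) ?_)
    refine (euclNorm_sum_le _ _).trans (sum_le_sum fun ℓ _ => ?_)
    refine (euclNorm_sub_le _ _).trans (add_le_add (hforce ℓ) (euclNorm_smul _ _).le)
  change z 0 ≤ ∑ ℓ ∈ range (k + 1), ε ℓ * u ℓ + ∑ ℓ ∈ Icc 1 k, γ ℓ * z ℓ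
  have hrange : ∑ ℓ ∈ range (k + 1), ε ℓ * u ℓ = ε 0 * u 0 + ∑ ℓ ∈ Icc 1 k, ε ℓ * u ℓ := by
    rw [range_eq_Ico, sum_eq_sum_Ico_succ_bot k.succ_pos]
    rfl
  have hscale : ∑ ℓ ∈ Icc 1 k, (|β ℓ| * Δt * (u ℓ + κ * z ℓ) + |α ℓ| * z ℓ)
      = h * (∑ ℓ ∈ Icc 1 k, ε ℓ * u ℓ + ∑ ℓ ∈ Icc 1 k, γ ℓ * z ℓ) := by
    rw [← sum_add_distrib, mul_sum]
    refine sum_congr rfl fun ℓ _ => ?_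
    rw [hε, hγ]
    field_simp
    ring
  have hε0 : h * ε 0 = |β 0| * Δt := by rw [hε]; field_simp
  rw [hrange, add_assoc]
  refine le_of_mul_le_mul_left ?_ hh
  rw [mul_add, ← hscale, ← mul_assoc, hε0]
  have hhz : h * z 0 = |α 0| * z 0 - |β 0| * κ * Δt * z 0 := by rw [hdef]; ring
  linarith
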